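/- arXiv:0906.2527 — 3 statements merged into one kernel-verified Lean document; each statement's English description precedes it below -/
import Mathlib

section
/- Let M be a linear subspace of the d×d complex matrices. Then there exist an integer d′ and d′×d complex matrices A_1,…,A_n with ∑_{k=1}^n A_k† A_k = I_d and span{A_k† A_l : 1 ≤ k, l ≤ n} = M if and only if M is closed under conjugate transpose (M† = M) and I_d ∈ M. -/
open Matrix
open scoped ComplexOrder

open scoped MatrixOrder Matrix.Norms.L2Operator in
lemma Matrix.IsHermitian.exists_posSemidef_smul_one_sub {m : Type*} [Fintype m] [DecidableEq m]
    {H : Matrix m m ℂ} (hH : H.IsHermitian) :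
    ∃ c : ℝ, 0 < c ∧ ((c : ℂ) • (1 : Matrix m m ℂ) - H).PosSemidef := by
  have hle := IsSelfAdjoint.le_algebraMap_norm_self (a := H) hH
  rw [Matrix.le_iff, Algebra.algebraMap_eq_smul_one] at hle
  refine ⟨‖H‖ + 1, by positivity, ?_⟩
  have hsplit : ((‖H‖ + 1 : ℝ) : ℂ) • (1 : Matrix m m ℂ) - H = (‖H‖ • 1 - H) + 1 := by
    rw [Complex.coe_smul, add_smul, one_smul]
    abel
  exact hsplit ▸ hle.add PosSemidef.one

/-- A subspace closed under conjugate transpose and containing `1` is spanned by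
positive semidefinite matrices. -/
lemma Matrix.span_posSemidef_inter_eq {m : Type*} [Fintype m] [DecidableEq m]
    {M : Submodule ℂ (Matrix m m ℂ)} (hstar : ∀ X ∈ M, Xᴴ ∈ M) (hone : 1 ∈ M) :
    Submodule.span ℂ {P : Matrix m m ℂ | P ∈ M ∧ P.PosSemidef} = M := by
  refine le_antisymm (Submodule.span_le.2 fun P hP => hP.1) fun X hX => ?_
  set N := Submodule.span ℂ {P : Matrix m m ℂ | P ∈ M ∧ P.PosSemidef}
  have hermitian_mem : ∀ H ∈ M, H.IsHermitian → H ∈ N := fun H hHM hH => by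
    obtain ⟨c, -, hc⟩ := hH.exists_posSemidef_smul_one_sub
    have h1 : (1 : Matrix m m ℂ) ∈ N := Submodule.subset_span ⟨hone, PosSemidef.one⟩
    have h2 : (c : ℂ) • (1 : Matrix m m ℂ) - H ∈ N :=
      Submodule.subset_span ⟨M.sub_mem (M.smul_mem _ hone) hHM, hc⟩
    simpa using N.sub_mem (N.smul_mem (c : ℂ) h1) h2
  have hre : X + Xᴴ ∈ N := hermitian_mem _ (M.add_mem hX (hstar X hX)) <| by
    simp [IsHermitian, add_comm]
  have him : Complex.I • (X - Xᴴ) ∈ N :=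
    hermitian_mem _ (M.smul_mem _ (M.sub_mem hX (hstar X hX))) <| by
      simp [IsHermitian, ← smul_neg]
  have hX' : X = (1 / 2 : ℂ) • ((X + Xᴴ) - Complex.I • Complex.I • (X - Xᴴ)) := by
    rw [smul_smul, Complex.I_mul_I]
    module
  rw [hX']
  exact N.smul_mem _ (N.sub_mem hre (N.smul_mem _ him))

open scoped MatrixOrder Matrix.Norms.L2Operator in
/-- Positive semidefinite matrices are the products `A k† A k` of a family whose mixed products
vanish. -/
lemma Matrix.exists_conjTranspose_mul_eq_ite {m ι : Type*} [Fintype m] [DecidableEq m]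
    [Fintype ι] [DecidableEq ι] {P : ι → Matrix m m ℂ} (hP : ∀ i, (P i).PosSemidef) :
    ∃ (r : ℕ) (A : ι → Matrix (Fin r) m ℂ), ∀ i j, (A i)ᴴ * A j = if i = j then P i else 0 := by
  choose B hB using fun i => CStarAlgebra.nonneg_iff_eq_star_mul_self.1 (hP i).nonneg
  let e := (Fintype.equivFin (ι × m)).symm
  refine ⟨_, fun i => of fun x b => if (e x).1 = i then B i (e x).2 b else 0, fun i j => ?_⟩
  ext a b
  rw [mul_apply]
  simp only [conjTranspose_apply, of_apply]
  rw [e.sum_comp (fun y : ι × m =>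
    star (if y.1 = i then B i y.2 a else 0) * if y.1 = j then B j y.2 b else 0),
    Fintype.sum_prod_type]
  rw [Finset.sum_eq_single i (by simp +contextual) (by simp)]
  split_ifs with h
  · subst h
    simp [hB i, mul_apply, star_eq_conjTranspose]
  · simp

lemma Matrix.exists_posSemidef_family_sum_eq_one {m : Type*} [Fintype m] [DecidableEq m]
    {M : Submodule ℂ (Matrix m m ℂ)} (hstar : ∀ X ∈ M, Xᴴ ∈ M) (hone : 1 ∈ M) :
    ∃ (n : ℕ) (P : Fin n → Matrix m m ℂ), (∀ i, (P i).PosSemidef) ∧ ∑ i, P i = 1 ∧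
      Submodule.span ℂ (Set.range P) = M := by
  have hspan := span_posSemidef_inter_eq hstar hone
  obtain ⟨S, hS, hSM⟩ := Submodule.fg_span_iff_fg_span_finset_subset _ |>.1
    (IsNoetherian.noetherian (Submodule.span ℂ {P : Matrix m m ℂ | P ∈ M ∧ P.PosSemidef}))
  rw [hspan] at hSM
  have hpos : (∑ s : S, (s : Matrix m m ℂ)).PosSemidef :=
    posSemidef_sum _ fun s _ => (hS s.2).2
  have hmem : ∑ s : S, (s : Matrix m m ℂ) ∈ M := M.sum_mem fun s _ => (hS s.2).1
  obtain ⟨c, hc, hcQ⟩ := hpos.isHermitian.exists_posSemidef_smul_one_sub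
  have hc0 : (c : ℂ) ≠ 0 := by exact_mod_cast hc.ne'
  have hcinv : (0 : ℂ) ≤ (c : ℂ)⁻¹ := by
    rw [← Complex.ofReal_inv]
    exact_mod_cast (inv_pos.2 hc).le
  let R : Option S → Matrix m m ℂ := fun o =>
    (c : ℂ)⁻¹ • o.elim ((c : ℂ) • 1 - ∑ s : S, (s : Matrix m m ℂ)) (fun s => (s : Matrix m m ℂ))
  let e := (Fintype.equivFin (Option S)).symm
  refine ⟨_, R ∘ e, fun i => ?_, ?_, ?_⟩
  · refine PosSemidef.smul ?_ hcinv
    rcases e i with _ | s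
    · exact hcQ
    · exact (hS s.2).2
  · simp only [Function.comp_apply]
    rw [e.sum_comp R, Fintype.sum_option]
    simp only [R, Option.elim, ← Finset.smul_sum, ← smul_add, sub_add_cancel]
    rw [smul_smul, inv_mul_cancel₀ hc0, one_smul]
  · rw [e.surjective.range_comp]
    refine le_antisymm (Submodule.span_le.2 ?_) (hSM ▸ Submodule.span_le.2 fun s hs => ?_)
    · rintro _ ⟨_ | s, rfl⟩
      · exact M.smul_mem _ (M.sub_mem (M.smul_mem _ hone) hmem)
      · exact M.smul_mem _ (hS s.2).1
    · have := Submodule.smul_mem _ (c : ℂ)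
        (Submodule.subset_span (R := ℂ) (Set.mem_range_self (f := R) (some ⟨s, hs⟩)))
      simpa [R, smul_smul, hc0] using this

/-- a matrix subspace `M` arises as `span {A_k† A_l}` for some Kraus family
iff `M† = M` and `I ∈ M`. -/
theorem stmt_1 {d : ℕ} (M : Submodule ℂ (Matrix (Fin d) (Fin d) ℂ)) :
    (∃ (d' n : ℕ) (A : Fin n → Matrix (Fin d') (Fin d) ℂ),
        (∑ k, (A k)ᴴ * A k = 1) ∧
        Submodule.span ℂ {X : Matrix (Fin d) (Fin d) ℂ | ∃ k l, X = (A k)ᴴ * A l} = M) ↔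
    ((fun X : Matrix (Fin d) (Fin d) ℂ => Xᴴ) '' (M : Set (Matrix (Fin d) (Fin d) ℂ)) = M ∧
      (1 : Matrix (Fin d) (Fin d) ℂ) ∈ M) := by
  constructor
  · rintro ⟨d', n, A, hA, rfl⟩
    refine ⟨?_, hA ▸ Submodule.sum_mem _ fun k _ => Submodule.subset_span ⟨k, k, rfl⟩⟩
    set K := Submodule.span ℂ {X : Matrix (Fin d) (Fin d) ℂ | ∃ k l, X = (A k)ᴴ * A l}
    have hstar : ∀ X ∈ K, Xᴴ ∈ K := fun X hX => by
      induction hX using Submodule.span_induction with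
      | mem X hX =>
        obtain ⟨k, l, rfl⟩ := hX
        exact Submodule.subset_span ⟨l, k, by simp⟩
      | zero => simp
      | add X Y _ _ hX hY => simpa using K.add_mem hX hY
      | smul a X _ hX => simpa using K.smul_mem (star a) hX
    exact Set.Subset.antisymm (Set.image_subset_iff.2 hstar)
      fun X hX => ⟨Xᴴ, hstar X hX, conjTranspose_conjTranspose X⟩
  · rintro ⟨hM, hone⟩
    have hstar : ∀ X ∈ M, Xᴴ ∈ M := fun X hX =>
      hM.subset (Set.mem_image_of_mem (fun X : Matrix (Fin d) (Fin d) ℂ => Xᴴ) hX)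
    obtain ⟨n, P, hpos, hsum, rfl⟩ := exists_posSemidef_family_sum_eq_one hstar hone
    obtain ⟨d', A, hA⟩ := exists_conjTranspose_mul_eq_ite hpos
    refine ⟨d', n, A, by simpa [hA] using hsum, le_antisymm (Submodule.span_le.2 ?_)
      (Submodule.span_mono ?_)⟩
    · rintro _ ⟨k, l, rfl⟩
      rw [hA]
      split_ifs
      · exact Submodule.subset_span ⟨k, rfl⟩
      · exact Submodule.zero_mem _
    · rintro _ ⟨k, rfl⟩
      exact ⟨k, k, by simp [hA]⟩
end

section
/- There exist an integer d′ and two Kraus families E_1,…,E_n and F_1,…,F_m of d′×4 complex matrices with ∑_k E_k†E_k = I_4 and ∑_j F_j†F_j = I_4, defining channels E and F on 4×4 matrices, such that: (i) for all unit vectors ψ, φ ∈ ℂ⁴, tr[E(|ψ⟩⟨ψ|)·E(|φ⟩⟨φ|)] ≠ 0 and tr[F(|ψ⟩⟨ψ|)·F(|φ⟩⟨φ|)] ≠ 0 (so α(E) = α(F) = 1); and (ii) there exist unit vectors Ψ_0, Ψ_1 ∈ ℂ⁴⊗ℂ⁴ with tr[(E⊗F)(|Ψ_0⟩⟨Ψ_0|)·(E⊗F)(|Ψ_1⟩⟨Ψ_1|)]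 = 0, where E⊗F is the channel with Kraus operators {E_k ⊗ F_j} (so α(E⊗F) > 1). -/
open Matrix Kronecker

/-- The quantum channel associated with a Kraus family: `ρ ↦ ∑ k, E k * ρ * (E k)ᴴ`. -/
noncomputable def channelApply {ι m n : Type*} [Fintype ι] [Fintype m] [Fintype n]
    (E : ι → Matrix m n ℂ) (ρ : Matrix n n ℂ) : Matrix m m ℂ :=
  ∑ k, E k * ρ * (E k)ᴴ

/-- The overlap of two channel outputs is governed by the operators `(E j)ᴴ * E k`. -/
theorem trace_channelApply_mul_channelApply {ι m n : Type*} [Fintype ι] [Fintype m] [Fintype n]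
    (E : ι → Matrix m n ℂ) (ψ φ : n → ℂ) :
    (channelApply E (vecMulVec ψ (star ψ)) * channelApply E (vecMulVec φ (star φ))).trace =
      ((∑ j, ∑ k, Complex.normSq (star ψ ⬝ᵥ ((E j)ᴴ * E k) *ᵥ φ) : ℝ) : ℂ) := by
  have outer (A : Matrix m n ℂ) (χ : n → ℂ) :
      A * vecMulVec χ (star χ) * Aᴴ = vecMulVec (A *ᵥ χ) (star (A *ᵥ χ)) := by
    rw [mul_vecMulVec, vecMulVec_mul, star_mulVec]
  simp only [channelApply, outer, Matrix.sum_mul, Matrix.mul_sum, trace_sum]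
  push_cast
  rw [Finset.sum_comm]
  refine Finset.sum_congr rfl fun j _ => Finset.sum_congr rfl fun k _ => ?_
  have inner_eq : star ψ ⬝ᵥ ((E j)ᴴ * E k) *ᵥ φ = star (E j *ᵥ ψ) ⬝ᵥ (E k *ᵥ φ) := by
    rw [star_mulVec, ← dotProduct_mulVec, mulVec_mulVec]
  rw [inner_eq, ← Complex.mul_conj, vecMulVec_mul_vecMulVec, trace_vecMulVec, dotProduct_smul,
    smul_eq_mul, starRingEnd_apply, ← star_dotProduct_star, star_star,
    dotProduct_comm (E j *ᵥ ψ), mul_comm]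

theorem trace_channelApply_mul_channelApply_eq_zero_iff {ι m n : Type*}
    [Fintype ι] [Fintype m] [Fintype n] (E : ι → Matrix m n ℂ) (ψ φ : n → ℂ) :
    (channelApply E (vecMulVec ψ (star ψ)) * channelApply E (vecMulVec φ (star φ))).trace = 0 ↔
      ∀ j k, star ψ ⬝ᵥ ((E j)ᴴ * E k) *ᵥ φ = 0 := by
  rw [trace_channelApply_mul_channelApply, Complex.ofReal_eq_zero,
    Finset.sum_eq_zero_iff_of_nonneg fun j _ => Finset.sum_nonneg fun k _ => Complex.normSq_nonneg _]
  simp [Finset.sum_eq_zero_iff_of_nonneg, Complex.normSq_nonneg]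

/-- Unitaries spanning an eight-dimensional operator system, closed under adjoints, whose
orthogonal complement contains no matrix of rank one. -/
noncomputable def graphUnitary : Fin 8 → Matrix (Fin 4) (Fin 4) ℂ :=
  ![!![1, 0, 0, 0; 0, 1, 0, 0; 0, 0, 1, 0; 0, 0, 0, 1],
    !![1, 0, 0, 0; 0, -1, 0, 0; 0, 0, 1, 0; 0, 0, 0, -1],
    !![0, 1, 0, 0; 1, 0, 0, 0; 0, 0, 0, 1; 0, 0, 1, 0],
    !![0, 1, 0, 0; -1, 0, 0, 0; 0, 0, 0, 1; 0, 0, -1, 0],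
    !![0, 0, 1, 0; 0, 0, 0, 1; 1, 0, 0, 0; 0, 1, 0, 0],
    !![0, 0, 1, 0; 0, 0, 0, -1; -1, 0, 0, 0; 0, 1, 0, 0],
    !![0, 0, 0, 1; 0, 0, 1, 0; 0, Complex.I, 0, 0; Complex.I, 0, 0, 0],
    !![0, 0, 0, 1; 0, 0, -1, 0; 0, -Complex.I, 0, 0; Complex.I, 0, 0, 0]]

theorem graphUnitary_zero : graphUnitary 0 = 1 := by
  ext i j
  fin_cases i <;> fin_cases j <;> simp [graphUnitary]

theorem conjTranspose_mul_graphUnitary (c : Fin 8) :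
    (graphUnitary c)ᴴ * graphUnitary c = 1 := by
  fin_cases c <;> ext i j <;> fin_cases i <;> fin_cases j <;>
    simp [graphUnitary, Matrix.mul_apply, Fin.sum_univ_four]

theorem conjTranspose_graphUnitary (c : Fin 8) :
    (graphUnitary c)ᴴ =
      (![1, 1, 1, -1, 1, -1, -Complex.I, -Complex.I] c : ℂ) • graphUnitary c := by
  fin_cases c <;> ext i j <;> fin_cases i <;> fin_cases j <;> simp [graphUnitary]

/-- The bilinear system expressing orthogonality to the operator system of `graphUnitary`
has only trivial solutions. -/
theorem eq_zero_or_eq_zero_of_bilinear {I p₀ p₁ p₂ p₃ q₀ q₁ q₂ q₃ : ℂ} (hI : I ^ 2 = -1)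
    (h₁ : p₀ * q₀ + p₂ * q₂ = 0) (h₂ : p₁ * q₁ + p₃ * q₃ = 0)
    (h₃ : p₀ * q₁ + p₂ * q₃ = 0) (h₄ : p₁ * q₀ + p₃ * q₂ = 0)
    (h₅ : p₀ * q₂ + p₃ * q₁ = 0) (h₆ : p₁ * q₃ + p₂ * q₀ = 0)
    (h₇ : p₀ * q₃ + I * p₃ * q₀ = 0) (h₈ : p₁ * q₂ + I * p₂ * q₁ = 0) :
    (p₀ = 0 ∧ p₁ = 0 ∧ p₂ = 0 ∧ p₃ = 0) ∨ (q₀ = 0 ∧ q₁ = 0 ∧ q₂ = 0 ∧ q₃ = 0) := by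
  have I_ne : I ≠ 0 := by
    rintro rfl
    norm_num at hI
  by_cases hp₀ : p₀ = 0
  · subst hp₀
    grind
  right
  have hq₂ : q₂ = 0 := by
    by_contra hq₂
    have quartic : p₀ ^ 4 = I * p₂ ^ 2 * p₃ ^ 2 := by
      refine mul_right_cancel₀ hq₂ ?_
      linear_combination p₀ ^ 3 * h₅ - p₀ ^ 2 * p₃ * h₃ + p₀ * p₂ * p₃ * h₇ - I * p₂ * p₃ ^ 2 * h₁
    have cubic : p₀ ^ 3 * p₁ = -(p₂ ^ 3 * p₃) := by
      refine mul_right_cancel₀ hq₂ ?_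
      linear_combination p₀ ^ 3 * h₈ - I * p₀ ^ 2 * p₂ * h₃ + I * p₀ * p₂ ^ 2 * h₇
        - I ^ 2 * p₂ ^ 2 * p₃ * h₁ + p₂ ^ 3 * p₃ * q₂ * hI
    have hp₂ : p₂ ≠ 0 := by
      rintro rfl
      exact hp₀ (by simpa using quartic)
    have quadratic : p₀ * p₂ = I * p₁ * p₃ := by
      refine mul_right_cancel₀ hq₂ (mul_left_cancel₀ hp₂ ?_)
      linear_combination -p₀ ^ 2 * h₆ + p₀ * p₁ * h₇ + p₀ * p₂ * h₁ - I * p₁ * p₃ * h₁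
    have double : p₀ ^ 4 * p₂ = 0 := by
      linear_combination (p₀ ^ 3 * quadratic + I * p₃ * cubic + p₂ * quartic) / 2
    simp_all
  subst hq₂
  have hq₀ : q₀ = 0 := by simpa [hp₀] using h₁
  subst hq₀
  have hq₃ : q₃ = 0 := by simpa [hp₀] using h₇
  subst hq₃
  simpa [hp₀] using h₃

theorem eq_zero_or_eq_zero_of_graphUnitary (p q : Fin 4 → ℂ)
    (h : ∀ c, p ⬝ᵥ graphUnitary c *ᵥ q = 0) : p = 0 ∨ q = 0 := by
  have h0 := h 0
  have h1 := h 1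
  have h2 := h 2
  have h3 := h 3
  have h4 := h 4
  have h5 := h 5
  have h6 := h 6
  have h7 := h 7
  simp [graphUnitary, dotProduct, mulVec, Fin.sum_univ_four] at h0 h1 h2 h3 h4 h5 h6 h7
  have e1 : p 0 * q 0 + p 2 * q 2 = 0 := by linear_combination (h0 + h1) / 2
  have e2 : p 1 * q 1 + p 3 * q 3 = 0 := by linear_combination (h0 - h1) / 2
  have e3 : p 0 * q 1 + p 2 * q 3 = 0 := by linear_combination (h2 + h3) / 2
  have e4 : p 1 * q 0 + p 3 * q 2 = 0 := by linear_combination (h2 - h3) / 2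
  have e5 : p 0 * q 2 + p 3 * q 1 = 0 := by linear_combination (h4 + h5) / 2
  have e6 : p 1 * q 3 + p 2 * q 0 = 0 := by linear_combination (h4 - h5) / 2
  have e7 : p 0 * q 3 + Complex.I * p 3 * q 0 = 0 := by linear_combination (h6 + h7) / 2
  have e8 : p 1 * q 2 + Complex.I * p 2 * q 1 = 0 := by linear_combination (h6 - h7) / 2
  have ext_zero (v : Fin 4 → ℂ) (hv : v 0 = 0 ∧ v 1 = 0 ∧ v 2 = 0 ∧ v 3 = 0) : v = 0 := by
    obtain ⟨hv0, hv1, hv2, hv3⟩ := hv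
    ext i
    fin_cases i <;> assumption
  exact (eq_zero_or_eq_zero_of_bilinear Complex.I_sq e1 e2 e3 e4 e5 e6 e7 e8).imp
    (ext_zero p) (ext_zero q)

/-- The Kraus operators `1/4` and `graphUnitary c / 4`, for `c : Fin 8`, where the outputs for
different `c` lie in orthogonal blocks. -/
noncomputable def graphKraus (k : Fin 8 × Fin 2) : Matrix (Fin 8 × Fin 4) (Fin 4) ℂ :=
  of fun i j => if i.1 = k.1 then (1 / 4 : ℂ) * (![1, graphUnitary k.1] k.2) i.2 j else 0

theorem conjTranspose_graphKraus_mul (k l : Fin 8 × Fin 2) :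
    (graphKraus k)ᴴ * graphKraus l =
      if k.1 = l.1 then (1 / 16 : ℂ) • ((![1, graphUnitary k.1] k.2)ᴴ *
        ![1, graphUnitary l.1] l.2) else 0 := by
  ext i j
  rw [Matrix.mul_apply, Fintype.sum_prod_type, Finset.sum_eq_single k.1]
  · split_ifs with h
    · simp only [graphKraus, conjTranspose_apply, of_apply, if_true, h, Matrix.smul_apply, Matrix.mul_apply,
        Finset.mul_sum, smul_eq_mul]
      refine Finset.sum_congr rfl fun x _ => ?_
      simp only [star_mul', star_div₀, star_one, star_ofNat]
      ring
    · simp [graphKraus, h]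
  · intro b _ hb
    simp [graphKraus, hb]
  · simp

/-- `graphKraus` indexed by `Fin 16`, with output dimension `32`. -/
noncomputable def graphKrausFin (k : Fin 16) : Matrix (Fin 32) (Fin 4) ℂ :=
  (graphKraus ((finProdFinEquiv (m := 8) (n := 2)).symm k)).submatrix
    (finProdFinEquiv (m := 8) (n := 4)).symm id

theorem conjTranspose_graphKrausFin_mul (k l : Fin 16) :
    (graphKrausFin k)ᴴ * graphKrausFin l =
      (graphKraus ((finProdFinEquiv (m := 8) (n := 2)).symm k))ᴴ *
        graphKraus ((finProdFinEquiv (m := 8) (n := 2)).symm l) := by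
  rw [graphKrausFin, graphKrausFin, conjTranspose_submatrix, submatrix_mul_equiv, submatrix_id_id]

theorem sum_conjTranspose_graphKrausFin_mul : ∑ k, (graphKrausFin k)ᴴ * graphKrausFin k = 1 := by
  simp only [conjTranspose_graphKrausFin_mul]
  rw [Equiv.sum_comp (finProdFinEquiv (m := 8) (n := 2)).symm
    fun k => (graphKraus k)ᴴ * graphKraus k]
  simp only [conjTranspose_graphKraus_mul, if_true, Fintype.sum_prod_type, Fin.sum_univ_two,
    cons_val_zero, cons_val_one, conjTranspose_mul_graphUnitary, conjTranspose_one, mul_one,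
    Finset.sum_const, Finset.card_univ, Fintype.card_fin]
  module

theorem exists_smul_graphUnitary_eq (k l : Fin 16) :
    ∃ (μ : ℂ) (c : Fin 8), (graphKrausFin k)ᴴ * graphKrausFin l = μ • graphUnitary c := by
  rw [conjTranspose_graphKrausFin_mul, conjTranspose_graphKraus_mul]
  generalize (finProdFinEquiv (m := 8) (n := 2)).symm k = k'
  generalize (finProdFinEquiv (m := 8) (n := 2)).symm l = l'
  obtain ⟨c, a⟩ := k'
  obtain ⟨d, b⟩ := l'
  dsimp only
  split_ifs with h
  · subst h
    fin_cases a <;> fin_cases b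
    · exact ⟨1 / 16, 0, by simp [graphUnitary_zero]⟩
    · exact ⟨1 / 16, c, by simp⟩
    · exact ⟨_, c, by simp [conjTranspose_graphUnitary, smul_smul]; rfl⟩
    · exact ⟨1 / 16, 0, by simp [graphUnitary_zero, conjTranspose_mul_graphUnitary]⟩
  · exact ⟨0, 0, by simp⟩

theorem exists_conjTranspose_graphKrausFin_mul_eq (c : Fin 8) :
    ∃ k l : Fin 16, (graphKrausFin k)ᴴ * graphKrausFin l = (1 / 16 : ℂ) • graphUnitary c :=
  ⟨finProdFinEquiv (m := 8) (n := 2) (c, 0), finProdFinEquiv (m := 8) (n := 2) (c, 1), by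
    simp [conjTranspose_graphKrausFin_mul, conjTranspose_graphKraus_mul]⟩

theorem trace_channelApply_graphKrausFin_ne_zero (ψ φ : Fin 4 → ℂ) (hψ : star ψ ⬝ᵥ ψ = 1)
    (hφ : star φ ⬝ᵥ φ = 1) :
    (channelApply graphKrausFin (vecMulVec ψ (star ψ)) *
      channelApply graphKrausFin (vecMulVec φ (star φ))).trace ≠ 0 := by
  rw [Ne, trace_channelApply_mul_channelApply_eq_zero_iff]
  intro h
  have orth (c : Fin 8) : star ψ ⬝ᵥ graphUnitary c *ᵥ φ = 0 := by
    obtain ⟨k, l, hkl⟩ := exists_conjTranspose_graphKrausFin_mul_eq c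
    simpa [hkl, smul_mulVec] using h k l
  rcases eq_zero_or_eq_zero_of_graphUnitary _ _ orth with h0 | h0
  · simp [h0] at hψ
  · simp [h0] at hφ

/-- The vectorization of the diagonal matrix with diagonal `v`. -/
def diagonalVec (v : Fin 4 → ℂ) (p : Fin 4 × Fin 4) : ℂ :=
  diagonal v p.1 p.2

theorem star_diagonalVec_dotProduct (v w : Fin 4 → ℂ) :
    star (diagonalVec v) ⬝ᵥ diagonalVec w = star v ⬝ᵥ w := by
  simp [diagonalVec, dotProduct, Fintype.sum_prod_type, diagonal_apply]

theorem star_diagonalVec_dotProduct_kronecker_mulVec (v w : Fin 4 → ℂ)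
    (X Y : Matrix (Fin 4) (Fin 4) ℂ) :
    star (diagonalVec v) ⬝ᵥ (X ⊗ₖ Y) *ᵥ diagonalVec w =
      star v ⬝ᵥ (of fun i j => X i j * Y i j) *ᵥ w := by
  simp [diagonalVec, dotProduct, mulVec, Fintype.sum_prod_type, diagonal_apply,
    kroneckerMap_apply, apply_ite (starRingEnd ℂ)]

theorem dotProduct_graphUnitary_hadamard_mulVec (c d : Fin 8) :
    star ![1 / 2, -Complex.I / 2, 1 / 2, -Complex.I / 2] ⬝ᵥ
      (of fun i j => graphUnitary c i j * graphUnitary d i j) *ᵥ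
        ![1 / 2, -Complex.I / 2, -1 / 2, Complex.I / 2] = 0 := by
  have hI := Complex.I_mul_I
  fin_cases c <;> fin_cases d <;>
    simp [graphUnitary, dotProduct, mulVec, Fin.sum_univ_four] <;> grind

/-- there are two quantum channels `E`, `F` on `M_4(ℂ)` with `α(E) = α(F) = 1`
(no pair of unit input vectors has orthogonal outputs), while the tensor product channel
`E ⊗ F` admits two unit entangled inputs with orthogonal outputs, so `α(E ⊗ F) > 1`. -/
theorem stmt_8 :
    ∃ (d' n m : ℕ) (E : Fin n → Matrix (Fin d') (Fin 4) ℂ)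
      (F : Fin m → Matrix (Fin d') (Fin 4) ℂ),
      (∑ k, (E k)ᴴ * E k = 1) ∧ (∑ j, (F j)ᴴ * F j = 1) ∧
      (∀ ψ φ : Fin 4 → ℂ, star ψ ⬝ᵥ ψ = 1 → star φ ⬝ᵥ φ = 1 →
        (channelApply E (vecMulVec ψ (star ψ)) *
          channelApply E (vecMulVec φ (star φ))).trace ≠ 0 ∧
        (channelApply F (vecMulVec ψ (star ψ)) *
          channelApply F (vecMulVec φ (star φ))).trace ≠ 0) ∧
      (∃ Ψ₀ Ψ₁ : Fin 4 × Fin 4 → ℂ, star Ψ₀ ⬝ᵥ Ψ₀ = 1 ∧ star Ψ₁ ⬝ᵥ Ψ₁ = 1 ∧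
        (channelApply (fun p : Fin n × Fin m => E p.1 ⊗ₖ F p.2) (vecMulVec Ψ₀ (star Ψ₀)) *
          channelApply (fun p : Fin n × Fin m => E p.1 ⊗ₖ F p.2)
            (vecMulVec Ψ₁ (star Ψ₁))).trace = 0) := by
  refine ⟨32, 16, 16, graphKrausFin, graphKrausFin, sum_conjTranspose_graphKrausFin_mul,
    sum_conjTranspose_graphKrausFin_mul, fun ψ φ hψ hφ =>
      ⟨trace_channelApply_graphKrausFin_ne_zero ψ φ hψ hφ,
        trace_channelApply_graphKrausFin_ne_zero ψ φ hψ hφ⟩,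
    diagonalVec ![1 / 2, -Complex.I / 2, 1 / 2, -Complex.I / 2],
    diagonalVec ![1 / 2, -Complex.I / 2, -1 / 2, Complex.I / 2], ?_, ?_, ?_⟩
  · rw [star_diagonalVec_dotProduct]
    simp [dotProduct, Fin.sum_univ_four, map_ofNat]
    grind [Complex.I_mul_I]
  · rw [star_diagonalVec_dotProduct]
    simp [dotProduct, Fin.sum_univ_four, map_ofNat]
    grind [Complex.I_mul_I]
  · rw [trace_channelApply_mul_channelApply_eq_zero_iff]
    rintro ⟨j, j'⟩ ⟨k, k'⟩
    obtain ⟨μ, c, hc⟩ := exists_smul_graphUnitary_eq j k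
    obtain ⟨ν, d, hd⟩ := exists_smul_graphUnitary_eq j' k'
    dsimp only
    rw [conjTranspose_kronecker, ← mul_kronecker_mul, hc, hd, smul_kronecker, kronecker_smul,
      smul_mulVec, smul_mulVec, dotProduct_smul, dotProduct_smul,
      star_diagonalVec_dotProduct_kronecker_mulVec, dotProduct_graphUnitary_hadamard_mulVec,
      smul_zero, smul_zero]
end

section
/- There exist an integer d (one may take d = 8), an integer d′, and a Kraus family G_1,…,G_n of d′×d complex matrices with ∑_k G_k†G_k = I_d, defining a channel G, such that: (i) for all unit vectors ψ, φ ∈ ℂ^d, tr[G(|ψ⟩⟨ψ|)·G(|φ⟩⟨φ|)] ≠ 0 (so α(G) = 1, i.e. a single use of G cannot transmit any classical information with zero error); and (ii) there exist unit vectors Ψ_0, Ψ_1 ∈ ℂ^d⊗ℂ^d with tr[G^{⊗2}(|Ψ_0⟩⟨Ψ_0|)·G^{⊗2}(|Ψ_1⟩⟨Ψ_1|)] = 0, where G^{⊗2} is the channel with Kraus operators {G_k ⊗ G_l} (so α(G^{⊗2}) > 1 and C^{(0)}(G) ≥ 1/2). -/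
open Matrix Kronecker

/-- The trace overlap of two pure-state outputs, in terms of the products `(E k)ᴴ * E l`. -/
lemma trace_channelApply_mul {ι m n : Type*} [Fintype ι] [Fintype m] [Fintype n]
    (E : ι → Matrix m n ℂ) (ψ φ : n → ℂ) :
    (channelApply E (vecMulVec ψ (star ψ)) * channelApply E (vecMulVec φ (star φ))).trace =
      ((∑ k, ∑ l, Complex.normSq (star ψ ⬝ᵥ ((E k)ᴴ * E l) *ᵥ φ) : ℝ) : ℂ) := by
  have key : ∀ k l, (E k * vecMulVec ψ (star ψ) * (E k)ᴴ *
      (E l * vecMulVec φ (star φ) * (E l)ᴴ)).trace =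
      (Complex.normSq (star ψ ⬝ᵥ ((E k)ᴴ * E l) *ᵥ φ) : ℂ) := by
    intro k l
    have h1 : ∀ (i : ι) (v : n → ℂ), E i * vecMulVec v (star v) * (E i)ᴴ =
        vecMulVec (E i *ᵥ v) (star (E i *ᵥ v)) := by
      intro i v
      rw [mul_vecMulVec, vecMulVec_mul, star_mulVec]
    have h2 : star ψ ⬝ᵥ ((E k)ᴴ * E l) *ᵥ φ = star (E k *ᵥ ψ) ⬝ᵥ (E l *ᵥ φ) := by
      rw [star_mulVec, ← mulVec_mulVec, dotProduct_mulVec]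
    rw [h1, h1, h2, vecMulVec_mul_vecMulVec, trace_vecMulVec, dotProduct_smul, smul_eq_mul,
      Complex.normSq_eq_conj_mul_self, mul_comm]
    congr 1
    rw [starRingEnd_apply, ← star_dotProduct_star, star_star, dotProduct_comm]
  simp only [channelApply, Finset.sum_mul_sum, trace_sum, key]
  push_cast
  rfl

/-- The operator system from which the channel is built. -/
noncomputable def opSystem (p u v r a b c e : ℂ) : Matrix (Fin 4) (Fin 4) ℂ :=
  !![p, 3 * u, a, b; 3 * v, r, c, e; a, b, r, 4 * v; c, e, 4 * u, p]

/-- Elements of the operator system which, with their adjoints and `1`, span it. -/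
noncomputable def opGen : Fin 4 → Matrix (Fin 4) (Fin 4) ℂ :=
  ![opSystem 1 0 0 0 0 0 0 0, opSystem 0 (1 / 5) 0 0 0 0 0 0, opSystem 0 0 0 0 1 0 0 Complex.I,
    opSystem 0 0 0 0 0 1 0 0]

/-- Completions of the generators to isometries. -/
noncomputable def opCompl : Fin 4 → Matrix (Fin 4) (Fin 4) ℂ :=
  ![diagonal ![0, 1, 1, 0], diagonal ![1, 4 / 5, 3 / 5, 1], 0, diagonal ![1, 0, 1, 0]]

lemma opGen_opCompl (j : Fin 4) :
    (opGen j)ᴴ * opGen j + (opCompl j)ᴴ * opCompl j = 1 := by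
  fin_cases j <;> ext i k <;> fin_cases i <;> fin_cases k <;>
    simp [opGen, opCompl, opSystem, Matrix.mul_apply, Fin.sum_univ_four, diagonal, map_ofNat] <;> norm_num

/-- The Kraus family, with output flagged by the index of the generator. -/
noncomputable def flaggedKraus :
    Fin 4 × Fin 2 → Matrix (Fin 4 × (Fin 4 ⊕ Fin 4)) (Fin 4) ℂ :=
  fun x => of fun y k => if x.1 = y.1 then
    (![(3 / 10 : ℂ) • fromRows 1 0, (2 / 5 : ℂ) • fromRows (opGen x.1) (opCompl x.1)] x.2) y.2 k
    else 0

lemma flaggedKraus_mul (j j' : Fin 4) (s t : Fin 2) :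
    (flaggedKraus (j, s))ᴴ * flaggedKraus (j', t) = if j = j' then
      !![(9 / 100 : ℂ) • (1 : Matrix (Fin 4) (Fin 4) ℂ), (3 / 25 : ℂ) • opGen j;
        (3 / 25 : ℂ) • (opGen j)ᴴ, (4 / 25 : ℂ) • (1 : Matrix (Fin 4) (Fin 4) ℂ)] s t
      else 0 := by
  have h : (flaggedKraus (j, s))ᴴ * flaggedKraus (j', t) = if j = j' then
      (![(3 / 10 : ℂ) • fromRows 1 0, (2 / 5 : ℂ) • fromRows (opGen j) (opCompl j)] s)ᴴ *
      (![(3 / 10 : ℂ) • fromRows 1 0, (2 / 5 : ℂ) • fromRows (opGen j) (opCompl j)] t)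
      else 0 := by
    split_ifs with hj
    · subst hj
      ext i k
      simp only [mul_apply, Fintype.sum_prod_type, flaggedKraus, conjTranspose_apply, of_apply]
      rw [Finset.sum_eq_single j]
      · simp
      · intro b _ hb
        simp [hb.symm]
      · simp
    · ext i k
      simp only [mul_apply, Fintype.sum_prod_type, flaggedKraus, conjTranspose_apply, of_apply,
        Matrix.zero_apply]
      refine Finset.sum_eq_zero fun b _ => Finset.sum_eq_zero fun c _ => ?_
      by_cases hb : j = b
      · have : j' ≠ b := fun h => hj (hb.trans h.symm)
        simp [this]
      · simp [hb]
  rw [h]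
  congr 1
  fin_cases s <;> fin_cases t <;>
    simp [conjTranspose_fromRows_eq_fromCols_conjTranspose, fromCols_mul_fromRows, smul_smul,
      opGen_opCompl] <;> norm_num

lemma sum_flaggedKraus : ∑ x, (flaggedKraus x)ᴴ * flaggedKraus x = 1 := by
  simp only [Fintype.sum_prod_type, flaggedKraus_mul, Fin.sum_univ_four, Fin.sum_univ_two]
  simp [← add_smul]
  norm_num

lemma flaggedKraus_mul_mem (x y : Fin 4 × Fin 2) : ∃ p u v r a b c e : ℂ,
    (flaggedKraus x)ᴴ * flaggedKraus y = opSystem p u v r a b c e := by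
  have hone : (1 : Matrix (Fin 4) (Fin 4) ℂ) = opSystem 1 0 0 1 0 0 0 0 := by
    ext i k; fin_cases i <;> fin_cases k <;> simp [opSystem]
  have hsmul : ∀ t p u v r a b c e : ℂ, t • opSystem p u v r a b c e =
      opSystem (t * p) (t * u) (t * v) (t * r) (t * a) (t * b) (t * c) (t * e) := by
    intros
    ext i k; fin_cases i <;> fin_cases k <;> simp [opSystem] <;> ring
  have hstar : ∀ p u v r a b c e : ℂ, (opSystem p u v r a b c e)ᴴ =
      opSystem (star p) (star v) (star u) (star r) (star a) (star c) (star b) (star e) := by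
    intros
    ext i k; fin_cases i <;> fin_cases k <;> simp [opSystem]
  have hgen : ∀ j, ∃ p u v r a b c e : ℂ, opGen j = opSystem p u v r a b c e := by
    intro j
    fin_cases j <;> exact ⟨_, _, _, _, _, _, _, _, rfl⟩
  obtain ⟨j, s⟩ := x
  obtain ⟨j', t⟩ := y
  rw [flaggedKraus_mul]
  split_ifs
  · obtain ⟨p, u, v, r, a, b, c, e, h⟩ := hgen j
    rw [h, hstar, hone, hsmul, hsmul, hsmul, hsmul]
    fin_cases s <;> fin_cases t <;> exact ⟨_, _, _, _, _, _, _, _, rfl⟩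
  · refine ⟨0, 0, 0, 0, 0, 0, 0, 0, ?_⟩
    ext i k; fin_cases i <;> fin_cases k <;> simp [opSystem]

/-- No nonzero product vector is annihilated by the whole operator system. -/
lemma eq_zero_or_eq_zero_of_bilin {x₀ x₁ x₂ x₃ y₀ y₁ y₂ y₃ : ℂ}
    (hp : x₀ * y₀ + x₃ * y₃ = 0) (hr : x₁ * y₁ + x₂ * y₂ = 0)
    (hu : 3 * (x₀ * y₁) + 4 * (x₃ * y₂) = 0) (hv : 3 * (x₁ * y₀) + 4 * (x₂ * y₃) = 0)
    (ha : x₀ * y₂ + x₂ * y₀ = 0) (hb : x₀ * y₃ + x₂ * y₁ = 0)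
    (hc : x₁ * y₂ + x₃ * y₀ = 0) (he : x₁ * y₃ + x₃ * y₁ = 0) :
    (x₀ = 0 ∧ x₁ = 0 ∧ x₂ = 0 ∧ x₃ = 0) ∨ (y₀ = 0 ∧ y₁ = 0 ∧ y₂ = 0 ∧ y₃ = 0) := by
  by_cases h0 : x₀ = 0
  · subst h0
    by_cases h2 : x₂ = 0
    · subst h2
      by_cases h1 : x₁ = 0
      · subst h1
        by_cases h3 : x₃ = 0
        · simp [h3]
        · simp_all
      · simp_all
    · simp_all
  · right
    obtain ⟨l, rfl⟩ : ∃ l, x₂ = l * x₀ := ⟨x₂ / x₀, by field_simp⟩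
    have hy2 : y₂ = -(l * y₀) := mul_left_cancel₀ h0 (by linear_combination ha)
    have hy3 : y₃ = -(l * y₁) := mul_left_cancel₀ h0 (by linear_combination hb)
    subst hy2 hy3
    have hy : y₀ = 0 ∧ y₁ = 0 := by
      by_cases g0 : y₀ = 0
      · subst g0; simp_all
      by_cases g1 : y₁ = 0
      · subst g1; simp_all
      exfalso
      have k1 : 4 * y₀ ^ 2 = 3 * y₁ ^ 2 := by
        apply mul_left_cancel₀ h0
        linear_combination 4 * y₀ * hp - y₁ * hu
      have k2 : 3 * y₀ ^ 2 = 4 * y₁ ^ 2 ∨ l = 0 := by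
        rw [or_iff_not_imp_right]
        intro hl
        have : l ^ 2 * x₀ ≠ 0 := by positivity
        apply mul_left_cancel₀ this
        linear_combination y₁ * hv - 3 * y₀ * hr
      rcases k2 with k2 | rfl
      · have : y₀ ^ 2 = 0 := by linear_combination (4 / 7 : ℂ) * k1 - (3 / 7 : ℂ) * k2
        exact g0 (by simpa using this)
      · simp_all
    simp [hy.1, hy.2]

lemma eq_zero_or_eq_zero_of_flaggedKraus (ψ φ : Fin 4 → ℂ)
    (h : ∀ x y, star ψ ⬝ᵥ ((flaggedKraus x)ᴴ * flaggedKraus y) *ᵥ φ = 0) : ψ = 0 ∨ φ = 0 := by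
  have h1 : star ψ ⬝ᵥ φ = 0 := by
    simpa [flaggedKraus_mul, smul_mulVec] using h (0, 0) (0, 0)
  have hA : ∀ j, star ψ ⬝ᵥ opGen j *ᵥ φ = 0 := fun j => by
    simpa [flaggedKraus_mul, smul_mulVec] using h (j, 0) (j, 1)
  have hB : ∀ j, star ψ ⬝ᵥ (opGen j)ᴴ *ᵥ φ = 0 := fun j => by
    simpa [flaggedKraus_mul, smul_mulVec] using h (j, 1) (j, 0)
  have a0 := hA 0
  have a1 := hA 1
  have a2 := hA 2
  have a3 := hA 3
  have b1 := hB 1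
  have b2 := hB 2
  have b3 := hB 3
  simp [opGen, opSystem, dotProduct, mulVec, Fin.sum_univ_four, map_ofNat] at h1 a0 a1 a2 a3 b1 b2 b3
  have key := eq_zero_or_eq_zero_of_bilin
    (x₀ := star (ψ 0)) (x₁ := star (ψ 1)) (x₂ := star (ψ 2)) (x₃ := star (ψ 3))
    (y₀ := φ 0) (y₁ := φ 1) (y₂ := φ 2) (y₃ := φ 3)
    (by simp; linear_combination a0) (by simp; linear_combination h1 - a0)
    (by simp; linear_combination 5 * a1) (by simp; linear_combination 5 * b1)
    (by simp; linear_combination (a2 + b2) / 2) (by simp; linear_combination a3)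
    (by simp; linear_combination b3)
    (by
      simp
      linear_combination (-Complex.I / 2) * (a2 - b2) +
        (starRingEnd ℂ (ψ 1) * φ 3 + starRingEnd ℂ (ψ 3) * φ 1) * Complex.I_sq)
  refine key.imp (fun hx => ?_) (fun hy => ?_)
  · simp only [star_eq_zero] at hx
    ext i
    fin_cases i
    exacts [hx.1, hx.2.1, hx.2.2.1, hx.2.2.2]
  · ext i
    fin_cases i
    exacts [hy.1, hy.2.1, hy.2.2.1, hy.2.2.2]

/-- The vector with coefficients `s i / 2` at `(i, i + 2)`. -/
noncomputable def swappedVec (s : Fin 4 → ℂ) : Fin 4 × Fin 4 → ℂ :=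
  fun x => if x.2 = x.1 + 2 then s x.1 / 2 else 0

lemma swappedVec_opSystem (p u v r a b c e p' u' v' r' a' b' c' e' : ℂ) :
    star (swappedVec ![1, 1, -1, -1]) ⬝ᵥ
      (opSystem p u v r a b c e ⊗ₖ opSystem p' u' v' r' a' b' c' e') *ᵥ swappedVec 1 = 0 := by
  have hs : ∀ (s : Fin 4 → ℂ) (f : Fin 4 × Fin 4 → ℂ),
      ∑ x, f x * swappedVec s x = ∑ i, f (i, i + 2) * (s i / 2) := by
    intro s f
    simp [Fintype.sum_prod_type, swappedVec]
  have hs' : star (swappedVec ![1, 1, -1, -1]) = swappedVec ![1, 1, -1, -1] := by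
    ext ⟨i, k⟩
    fin_cases i <;> simp [swappedVec, apply_ite (starRingEnd ℂ), map_ofNat]
  rw [hs', dotProduct_comm]
  simp only [dotProduct, mulVec, hs, kroneckerMap_apply, Fin.sum_univ_four]
  have e2 : (2 : Fin 4) + 2 = 0 := rfl
  have e3 : (3 : Fin 4) + 2 = 1 := rfl
  have e1 : (1 : Fin 4) + 2 = 3 := rfl
  simp [opSystem, e1, e2, e3]
  ring

lemma star_swappedVec_dotProduct (s : Fin 4 → ℂ) (h : ∀ i, star (s i) * s i = 1) :
    star (swappedVec s) ⬝ᵥ swappedVec s = 1 := by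
  have h' : ∀ i, (starRingEnd ℂ) (s i) / 2 * (s i / 2) = 1 / 4 := fun i => by
    have := h i
    rw [← starRingEnd_apply] at this
    linear_combination this / 4
  simp [dotProduct, Fintype.sum_prod_type, swappedVec, map_ofNat, h']

/-- there is a single quantum channel `G` (one may take input dimension `d = 8`)
with `α(G) = 1`, while the two-fold tensor power `G ⊗ G` admits two unit entangled inputs
with orthogonal outputs, so `α(G^{⊗2}) > 1` and `C⁰(G) ≥ 1/2`. -/
theorem stmt_9 :
    ∃ (d d' n : ℕ) (G : Fin n → Matrix (Fin d') (Fin d) ℂ),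
      (∑ k, (G k)ᴴ * G k = 1) ∧
      (∀ ψ φ : Fin d → ℂ, star ψ ⬝ᵥ ψ = 1 → star φ ⬝ᵥ φ = 1 →
        (channelApply G (vecMulVec ψ (star ψ)) *
          channelApply G (vecMulVec φ (star φ))).trace ≠ 0) ∧
      (∃ Ψ₀ Ψ₁ : Fin d × Fin d → ℂ, star Ψ₀ ⬝ᵥ Ψ₀ = 1 ∧ star Ψ₁ ⬝ᵥ Ψ₁ = 1 ∧
        (channelApply (fun p : Fin n × Fin n => G p.1 ⊗ₖ G p.2) (vecMulVec Ψ₀ (star Ψ₀)) *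
          channelApply (fun p : Fin n × Fin n => G p.1 ⊗ₖ G p.2)
            (vecMulVec Ψ₁ (star Ψ₁))).trace = 0) := by
  let eι := (Fintype.equivFin (Fin 4 × Fin 2)).symm
  let em := (Fintype.equivFin (Fin 4 × (Fin 4 ⊕ Fin 4))).symm
  have hmul : ∀ k l, ((flaggedKraus (eι k)).submatrix em id)ᴴ *
      (flaggedKraus (eι l)).submatrix em id =
        (flaggedKraus (eι k))ᴴ * flaggedKraus (eι l) := fun k l => by
    rw [conjTranspose_submatrix, submatrix_mul_equiv, submatrix_id_id]
  refine ⟨4, _, _, fun k => (flaggedKraus (eι k)).submatrix em id, ?_, ?_,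
    swappedVec ![1, 1, -1, -1], swappedVec 1, ?_, ?_, ?_⟩
  · simp only [hmul]
    rw [eι.sum_comp fun x => (flaggedKraus x)ᴴ * flaggedKraus x, sum_flaggedKraus]
  · intro ψ φ hψ hφ h
    rw [trace_channelApply_mul, Complex.ofReal_eq_zero,
      Finset.sum_eq_zero_iff_of_nonneg fun _ _ => Finset.sum_nonneg fun _ _ =>
        Complex.normSq_nonneg _] at h
    have h' : ∀ x y, star ψ ⬝ᵥ ((flaggedKraus x)ᴴ * flaggedKraus y) *ᵥ φ = 0 := by
      intro x y
      have hx := h (eι.symm x) (Finset.mem_univ _)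
      rw [Finset.sum_eq_zero_iff_of_nonneg fun _ _ => Complex.normSq_nonneg _] at hx
      have hy := hx (eι.symm y) (Finset.mem_univ _)
      rwa [Complex.normSq_eq_zero, hmul, eι.apply_symm_apply, eι.apply_symm_apply] at hy
    rcases eq_zero_or_eq_zero_of_flaggedKraus ψ φ h' with rfl | rfl
    · simp at hψ
    · simp at hφ
  · exact star_swappedVec_dotProduct _ fun i => by fin_cases i <;> simp
  · exact star_swappedVec_dotProduct _ fun i => by simp
  · rw [trace_channelApply_mul, Complex.ofReal_eq_zero]
    refine Finset.sum_eq_zero fun x _ => Finset.sum_eq_zero fun y _ => ?_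
    rw [Complex.normSq_eq_zero, conjTranspose_kronecker, ← mul_kronecker_mul, hmul, hmul]
    obtain ⟨p, u, v, r, a, b, c, e, h⟩ := flaggedKraus_mul_mem (eι x.1) (eι y.1)
    obtain ⟨p', u', v', r', a', b', c', e', h'⟩ := flaggedKraus_mul_mem (eι x.2) (eι y.2)
    rw [h, h', swappedVec_opSystem]
end
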